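/- Shape derivative of the volume functional: let θ : ℝ^d → ℝ^d be a continuously differentiable vector field with compact support, let Ω ⊆ ℝ^d be a Lebesgue-measurable set of finite measure, and set T_t(x) := x + t θ(x). Then for all sufficiently small |t| the map T_t is a bijection of ℝ^d, and the function t ↦ vol(T_t(Ω)) (Lebesgue measure of the image T_t(Ω)) is differentiable at t = 0 with derivative ∫_Ω div θ(x) dx, where div θ = trace(Dθ). -/

import Mathlib

open MeasureTheory

open Set Filter Topology Module
open scoped NNReal

/-- A perturbation of the identity by a strict contraction is bijective. -/
theorem LipschitzWith.bijective_id_add {E : Type*} [NormedAddCommGroup E] [NormedSpace ℝ E]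
    [CompleteSpace E] {u : E → E} {c : ℝ≥0} (hu : LipschitzWith c u) (hc : c < 1) :
    Function.Bijective (fun x => x + u x) := by
  have happ : ApproximatesLinearOn (fun x => x + u x)
      ((ContinuousLinearEquiv.refl ℝ E : E ≃L[ℝ] E) : E →L[ℝ] E) univ c := by
    rw [ApproximatesLinearOn.approximatesLinearOn_iff_lipschitzOnWith, lipschitzOnWith_univ]
    convert hu using 1
    ext x
    simp
  have hN : Subsingleton E ∨
      c < ‖((ContinuousLinearEquiv.refl ℝ E).symm : E →L[ℝ] E)‖₊⁻¹ := by
    rcases subsingleton_or_nontrivial E with h | h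
    · exact Or.inl h
    · right
      have : ‖((ContinuousLinearEquiv.refl ℝ E).symm : E →L[ℝ] E)‖₊ = 1 :=
        NNReal.eq ContinuousLinearMap.norm_id
      simpa [this] using hc
  exact ⟨injOn_univ.1 (happ.injOn hN), happ.surjective hN⟩

section Det

variable {E : Type*} [NormedAddCommGroup E] [NormedSpace ℝ E] [FiniteDimensional ℝ E]

theorem ContinuousLinearMap.contDiff_det {n : WithTop ℕ∞} :
    ContDiff ℝ n (fun A : E →L[ℝ] E => A.det) := by
  let b := finBasis ℝ E
  have h : (fun A : E →L[ℝ] E => A.det) = fun A : E →L[ℝ] E =>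
      ∑ σ : Equiv.Perm (Fin (finrank ℝ E)), (Equiv.Perm.sign σ : ℤ) •
        ∏ i, (b.coord (σ i)).toContinuousLinearMap (A (b i)) := by
    ext A
    rw [ContinuousLinearMap.det, ← LinearMap.det_toMatrix b, Matrix.det_apply]
    simp [LinearMap.toMatrix_apply, Units.smul_def]
  rw [h]
  simp only [zsmul_eq_mul]
  refine ContDiff.sum fun σ _ => contDiff_const.mul (contDiff_prod fun i _ => ?_)
  exact (ContinuousLinearMap.contDiff _).comp (contDiff_id.clm_apply contDiff_const)

theorem ContinuousLinearMap.hasDerivAt_det_one_add_smul (A : E →L[ℝ] E) :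
    HasDerivAt (fun t : ℝ => (1 + t • A).det) (LinearMap.trace ℝ E A) 0 := by
  let b := finBasis ℝ E
  let M := LinearMap.toMatrix b b (A : E →ₗ[ℝ] E)
  let p := (Matrix.det (1 + (Polynomial.X : Polynomial ℝ) • M.map Polynomial.C)).divX.divX
  have h : (fun t : ℝ => (1 + t • A).det) = fun t => 1 + M.trace * t + p.eval t * t ^ 2 := by
    ext t
    rw [← Matrix.det_one_add_smul, ContinuousLinearMap.det, ← LinearMap.det_toMatrix b]
    congr 1
    simp [M, LinearMap.toMatrix_one]
  rw [h, LinearMap.trace_eq_matrix_trace ℝ b]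
  have h1 := (((hasDerivAt_id (0 : ℝ)).const_mul M.trace).const_add 1).add
    ((p.hasDerivAt 0).mul ((hasDerivAt_id (0 : ℝ)).pow 2))
  refine h1.congr_deriv ?_
  simp [M]

theorem ContinuousLinearMap.hasDerivAt_abs_det_one_add_smul (A : E →L[ℝ] E) :
    HasDerivAt (fun t : ℝ => |(1 + t • A).det|) (LinearMap.trace ℝ E A) 0 := by
  refine (A.hasDerivAt_det_one_add_smul).congr_of_eventuallyEq ?_
  have h := A.hasDerivAt_det_one_add_smul.continuousAt.eventually (lt_mem_nhds (a := 0)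
    (by simp [ContinuousLinearMap.det]))
  filter_upwards [h] with t ht using abs_of_pos ht

/-- On a bounded set of endomorphisms `A`, the maps `t ↦ |det (1 + t A)|` are uniformly Lipschitz
near `0`. -/
theorem ContinuousLinearMap.exists_lipschitzOnWith_abs_det_one_add_smul (C : ℝ≥0) :
    ∃ K : ℝ≥0, ∃ s ∈ 𝓝 (0 : ℝ), ∀ A : E →L[ℝ] E, ‖A‖₊ ≤ C →
      LipschitzOnWith K (fun t : ℝ => |(1 + t • A).det|) s := by
  obtain ⟨K, u, hu, hK⟩ := (contDiff_det (E := E) (n := 1)).contDiffAt.exists_lipschitzOnWith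
    (x := (1 : E →L[ℝ] E))
  obtain ⟨r, hr, hru⟩ := Metric.mem_nhds_iff.1 hu
  refine ⟨1 * (K * C), Metric.ball 0 (r / (C + 1)), Metric.ball_mem_nhds _ (by positivity),
    fun A hA => ?_⟩
  have hmap : MapsTo (fun t : ℝ => 1 + t • A) (Metric.ball 0 (r / (C + 1))) u := by
    intro t ht
    apply hru
    rw [mem_ball_zero_iff, lt_div_iff₀ (by positivity)] at ht
    have hA' : ‖A‖ ≤ C := hA
    rw [Metric.mem_ball, dist_eq_norm, add_sub_cancel_left, norm_smul]
    nlinarith [norm_nonneg t]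
  have hlin : LipschitzWith C (fun t : ℝ => 1 + t • A) := by
    refine LipschitzWith.of_dist_le_mul fun x y => ?_
    rw [dist_add_left, dist_eq_norm, ← sub_smul, norm_smul, mul_comm, dist_eq_norm]
    gcongr
    exact hA
  have habs : LipschitzWith 1 (fun x : ℝ => |x|) := lipschitzWith_one_norm
  exact (habs.lipschitzOnWith (s := univ)).comp (hK.comp hlin.lipschitzOnWith hmap)
    (mapsTo_univ _ _)

end Det

/-- The derivative of the volume of a set under a perturbation of the identity. -/
theorem hasDerivAt_measure_image_id_add_smul {E : Type*} [NormedAddCommGroup E]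
    [NormedSpace ℝ E] [FiniteDimensional ℝ E] [MeasurableSpace E] [BorelSpace E]
    (μ : Measure E) [μ.IsAddHaarMeasure] {θ : E → E} {C : ℝ≥0} (hθ : ContDiff ℝ 1 θ)
    (hC : LipschitzWith C θ) {Ω : Set E} (hΩ : MeasurableSet Ω) (hvol : μ Ω < ⊤)
    (hinj : ∀ᶠ t in 𝓝 (0 : ℝ), Function.Injective (fun x => x + t • θ x)) :
    HasDerivAt (fun t : ℝ => (μ ((fun x => x + t • θ x) '' Ω)).toReal)
      (∫ x in Ω, LinearMap.trace ℝ E (fderiv ℝ θ x) ∂μ) 0 := by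
  have hfin : IsFiniteMeasure (μ.restrict Ω) := isFiniteMeasure_restrict.2 hvol.ne
  have hD : Continuous (fderiv ℝ θ) := hθ.continuous_fderiv one_ne_zero
  have hcont (t : ℝ) : Continuous fun x => |(1 + t • fderiv ℝ θ x).det| :=
    (ContinuousLinearMap.continuous_det.comp (continuous_const.add (hD.const_smul t))).abs
  have htrace : Continuous fun x => LinearMap.trace ℝ E (fderiv ℝ θ x) :=
    (LinearMap.continuous_of_finiteDimensional
      ((LinearMap.trace ℝ E).comp (ContinuousLinearMap.coeLM ℝ))).comp hD
  obtain ⟨K, s, hs, hK⟩ :=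
    ContinuousLinearMap.exists_lipschitzOnWith_abs_det_one_add_smul (E := E) C
  have key := (hasDerivAt_integral_of_dominated_loc_of_lip (μ := μ.restrict Ω)
    (F := fun (t : ℝ) x => |(1 + t • fderiv ℝ θ x).det|)
    (bound := fun _ => (K : ℝ)) hs
    (Eventually.of_forall fun t => (hcont t).aestronglyMeasurable)
    (by simp) htrace.aestronglyMeasurable
    (Eventually.of_forall fun x => by
      simpa using hK _ (norm_fderiv_le_of_lipschitz ℝ hC))
    (integrable_const _)
    (Eventually.of_forall fun x =>
      (fderiv ℝ θ x).hasDerivAt_abs_det_one_add_smul)).2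
  refine key.congr_of_eventuallyEq ?_
  filter_upwards [hinj] with t ht
  have hderiv (x : E) : HasFDerivAt (fun x => x + t • θ x) (1 + t • fderiv ℝ θ x) x :=
    (hasFDerivAt_id x).add ((hθ.differentiable one_ne_zero x).hasFDerivAt.const_smul t)
  rw [← lintegral_abs_det_fderiv_eq_addHaar_image μ hΩ
    (fun x _ => (hderiv x).hasFDerivWithinAt) ht.injOn,
    integral_eq_lintegral_of_nonneg_ae (Eventually.of_forall fun x => abs_nonneg _)
      (hcont t).aestronglyMeasurable]

theorem EuclideanSpace.trace_eq_sum_apply_single {ι : Type*} [Fintype ι] [DecidableEq ι]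
    (A : EuclideanSpace ℝ ι →ₗ[ℝ] EuclideanSpace ℝ ι) :
    LinearMap.trace ℝ _ A = ∑ i, A (EuclideanSpace.single i 1) i := by
  rw [LinearMap.trace_eq_matrix_trace ℝ (EuclideanSpace.basisFun ι ℝ).toBasis, Matrix.trace]
  simp [LinearMap.toMatrix_apply]

/-- **Shape derivative of the volume functional.**
For a compactly supported `C¹` vector field `θ` on `ℝ^d`, a measurable set
`Ω` of finite Lebesgue measure, and the perturbation of identity
`T_t(x) = x + t θ(x)`, the map `T_t` is a bijection for all sufficiently
small `|t|`, and `t ↦ vol(T_t(Ω))` is differentiable at `t = 0` with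
derivative `∫_Ω div θ`, where `div θ = trace(Dθ)`. -/
theorem stmt_11 {d : ℕ}
    (θ : EuclideanSpace ℝ (Fin d) → EuclideanSpace ℝ (Fin d))
    (hθ : ContDiff ℝ 1 θ) (hsupp : HasCompactSupport θ)
    (Ω : Set (EuclideanSpace ℝ (Fin d))) (hΩ : MeasurableSet Ω)
    (hvol : volume Ω < ⊤) :
    (∃ ε > 0, ∀ t : ℝ, |t| < ε →
      Function.Bijective (fun x : EuclideanSpace ℝ (Fin d) => x + t • θ x)) ∧
    HasDerivAt
      (fun t : ℝ =>
        (volume ((fun x : EuclideanSpace ℝ (Fin d) => x + t • θ x) '' Ω)).toReal)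
      (∫ x in Ω, ∑ i, fderiv ℝ θ x (EuclideanSpace.single i 1) i) 0 := by
  obtain ⟨C, hC⟩ := hθ.lipschitzWith_of_hasCompactSupport hsupp one_ne_zero
  have hbij : ∀ t : ℝ, |t| < 1 / (C + 1) →
      Function.Bijective (fun x : EuclideanSpace ℝ (Fin d) => x + t • θ x) := by
    intro t ht
    refine LipschitzWith.bijective_id_add (c := ‖t‖₊ * C) ((lipschitzWith_smul t).comp hC) ?_
    rw [lt_div_iff₀ (by positivity)] at ht
    rw [← NNReal.coe_lt_coe]
    push_cast
    rw [Real.norm_eq_abs]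
    nlinarith [abs_nonneg t]
  refine ⟨⟨1 / (C + 1), by positivity, hbij⟩, ?_⟩
  have hinj : ∀ᶠ t in 𝓝 (0 : ℝ),
      Function.Injective (fun x : EuclideanSpace ℝ (Fin d) => x + t • θ x) := by
    filter_upwards [Metric.ball_mem_nhds (0 : ℝ) (show 0 < 1 / ((C : ℝ) + 1) by positivity)]
      with t ht
    exact (hbij t (by simpa using ht)).injective
  simpa only [EuclideanSpace.trace_eq_sum_apply_single, ContinuousLinearMap.coe_coe] using
    hasDerivAt_measure_image_id_add_smul volume hθ hC hΩ hvol hinj
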